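/- arXiv:2207.03420 — 2 statements merged into one kernel-verified Lean document; each statement's English description precedes it below -/
import Mathlib

section
/- Let ω be a weight on ℝ₊ with ω ∈ B_p(0), 1 < p < ∞, u ∈ D^{1,p}(ℝ₊,ω) and c ∈ ℝ. Then the following are equivalent: (a) there exists a sequence t_n ↓ 0 with u(t_n) → c; (b) lim_{t→0⁺} u(t) = c; (c) lim_{t→0⁺} (u(t) − c)/Ω^0_ω(t) = 0 and sup_{t>0} (u(t) − c)/Ω^0_ω(t) < ∞; (d) u ∈ R^0_{p,ω}(c). -/
open MeasureTheory Set Filter Topology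
open scoped NNReal ENNReal

noncomputable section

/-- A weight on `ℝ₊ = (0,∞)`: continuous and positive there. -/
def IsWeight (ω : ℝ → ℝ) : Prop :=
  ContinuousOn ω (Set.Ioi 0) ∧ ∀ t : ℝ, 0 < t → 0 < ω t

/-- Membership of the pair `(u, u')` in the weighted Dirichlet space
`D^{1,p}(ℝ₊, ω)`: `u'` is locally integrable on `(0,∞)`, `u` is locally
absolutely continuous with derivative `u'`, and `∫_0^∞ |u'|^p ω < ∞`. -/
def MemD (p : ℝ) (ω u u' : ℝ → ℝ) : Prop :=
  (∀ a b : ℝ, 0 < a → a < b → IntegrableOn u' (Set.Ioc a b)) ∧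
  (∀ a b : ℝ, 0 < a → a < b → u b - u a = ∫ τ in a..b, u' τ) ∧
  IntegrableOn (fun t => |u' t| ^ p * ω t) (Set.Ioi 0)

/-- `‖u'‖_{L^p(ℝ₊, ω)} = (∫_0^∞ |u'(t)|^p ω(t) dt)^{1/p}`. -/
def dNorm (p : ℝ) (ω u' : ℝ → ℝ) : ℝ :=
  (∫ t in Set.Ioi (0:ℝ), |u' t| ^ p * ω t) ^ (1 / p)

/-- The norm `‖u‖^{(a)} = |u(a)| + ‖u'‖_{L^p(ℝ₊, ω)}`. -/
def aNorm (p : ℝ) (ω : ℝ → ℝ) (a : ℝ) (u u' : ℝ → ℝ) : ℝ :=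
  |u a| + dNorm p ω u'

/-- `ω ∈ B_p(0)`: `∫_0^1 ω(t)^{-1/(p-1)} dt < ∞`. -/
def Bp0 (p : ℝ) (ω : ℝ → ℝ) : Prop :=
  IntegrableOn (fun t => ω t ^ (-1 / (p - 1))) (Set.Ioc (0:ℝ) 1)

/-- `ω ∈ B_p(∞)`: `∫_1^∞ ω(t)^{-1/(p-1)} dt < ∞`. -/
def BpInf (p : ℝ) (ω : ℝ → ℝ) : Prop :=
  IntegrableOn (fun t => ω t ^ (-1 / (p - 1))) (Set.Ioi (1:ℝ))

/-- `Ω^0_ω(t) = (∫_0^t ω(τ)^{-1/(p-1)} dτ)^{1-1/p}`. -/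
def Omega0 (p : ℝ) (ω : ℝ → ℝ) (t : ℝ) : ℝ :=
  (∫ τ in Set.Ioc (0:ℝ) t, ω τ ^ (-1 / (p - 1))) ^ (1 - 1 / p)

/-- `Ω^∞_ω(t) = (∫_t^∞ ω(τ)^{-1/(p-1)} dτ)^{1-1/p}`. -/
def OmegaInf (p : ℝ) (ω : ℝ → ℝ) (t : ℝ) : ℝ :=
  (∫ τ in Set.Ioi t, ω τ ^ (-1 / (p - 1))) ^ (1 - 1 / p)

/-- `R^0_{p,ω}(c)`: elements of `D^{1,p}(ℝ₊,ω)` with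
`u(t) = c + ∫_0^t u'(τ) dτ` for every `t > 0`. -/
def MemR0 (p : ℝ) (ω : ℝ → ℝ) (c : ℝ) (u u' : ℝ → ℝ) : Prop :=
  MemD p ω u u' ∧ ∀ t : ℝ, 0 < t →
    IntegrableOn u' (Set.Ioc 0 t) ∧ u t = c + ∫ τ in Set.Ioc (0:ℝ) t, u' τ

/-- `R^∞_{p,ω}(c)`: elements of `D^{1,p}(ℝ₊,ω)` with
`u(t) = c - ∫_t^∞ u'(τ) dτ` for every `t > 0`. -/
def MemRInf (p : ℝ) (ω : ℝ → ℝ) (c : ℝ) (u u' : ℝ → ℝ) : Prop :=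
  MemD p ω u u' ∧ ∀ t : ℝ, 0 < t →
    IntegrableOn u' (Set.Ioi t) ∧ u t = c - ∫ τ in Set.Ioi t, u' τ

/-- `D_0^{1,p}(ℝ₊,ω)`: elements of `D^{1,p}(ℝ₊,ω)` approximable by smooth
compactly supported functions on `(0,∞)`, with derivatives converging in
`L^p(ℝ₊,ω)` and locally uniform convergence on compact subsets of `(0,∞)`. -/
def MemD0 (p : ℝ) (ω u u' : ℝ → ℝ) : Prop :=
  MemD p ω u u' ∧
  ∃ φ : ℕ → ℝ → ℝ,
    (∀ n, ContDiff ℝ (⊤ : ℕ∞) (φ n) ∧ HasCompactSupport (φ n) ∧ tsupport (φ n) ⊆ Set.Ioi 0) ∧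
    Tendsto (fun n => ∫ t in Set.Ioi (0:ℝ), |deriv (φ n) t - u' t| ^ p * ω t)
      atTop (𝓝 0) ∧
    (∀ K : Set ℝ, K ⊆ Set.Ioi 0 → IsCompact K →
      TendstoUniformlyOn (fun n => φ n) u atTop K)

section
variable {p c : ℝ} {ω u u' : ℝ → ℝ}

lemma tendsto_setIntegral_Ioc_zero {f : ℝ → ℝ} (hf : IntegrableOn f (Ioc (0:ℝ) 1)) :
    Tendsto (fun t => ∫ τ in Ioc (0:ℝ) t, f τ) (𝓝[>] 0) (𝓝 0) := by
  have h := intervalIntegral.continuousOn_primitive (μ := volume) (a := 0) (b := 1)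
    ((integrableOn_Icc_iff_integrableOn_Ioc (by simp)).2 hf) 0 (by simp)
  have h' := h.tendsto.mono_left (nhdsWithin_le_of_mem (t := Ioi 0)
    (mem_of_superset (Ioc_mem_nhdsGT (zero_lt_one' ℝ)) Ioc_subset_Icc_self))
  simpa using h'

lemma IsWeight.integrableOn_rpow (hω : IsWeight ω) (hB : Bp0 p ω) (t : ℝ) :
    IntegrableOn (fun τ => ω τ ^ (-1 / (p - 1))) (Ioc (0:ℝ) t) := by
  have hc : ContinuousOn (fun τ => ω τ ^ (-1 / (p - 1))) (Icc 1 t) :=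
    (hω.1.mono fun x hx => lt_of_lt_of_le one_pos hx.1).rpow_const
      fun x hx => Or.inl (hω.2 x (lt_of_lt_of_le one_pos hx.1)).ne'
  refine (IntegrableOn.union hB hc.integrableOn_Icc).mono_set fun x hx => ?_
  rcases le_total x 1 with h | h
  · exact Or.inl ⟨hx.1, h⟩
  · exact Or.inr ⟨h, hx.2⟩

lemma IsWeight.Omega0_pos (hω : IsWeight ω) (hB : Bp0 p ω) {t : ℝ} (ht : 0 < t) :
    0 < Omega0 p ω t := by
  refine Real.rpow_pos_of_pos ?_ _
  rw [← intervalIntegral.integral_of_le ht.le]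
  exact intervalIntegral.intervalIntegral_pos_of_pos_on
    ((intervalIntegrable_iff_integrableOn_Ioc_of_le ht.le).2 (hω.integrableOn_rpow hB t))
    (fun x hx => Real.rpow_pos_of_pos (hω.2 x hx.1) _) ht

lemma tendsto_Omega0_zero (hp : 1 < p) (hB : Bp0 p ω) :
    Tendsto (Omega0 p ω) (𝓝[>] 0) (𝓝 0) := by
  have hq : 0 < 1 - 1 / p := by
    rw [sub_pos, div_lt_one (by linarith)]; exact hp
  have h := (tendsto_setIntegral_Ioc_zero hB).rpow_const (p := 1 - 1 / p) (Or.inr hq.le)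
  rwa [Real.zero_rpow hq.ne'] at h

lemma MemD.aestronglyMeasurable (hu : MemD p ω u u') :
    AEStronglyMeasurable u' (volume.restrict (Ioi (0:ℝ))) := by
  have hs : Ioi (0:ℝ) ⊆ ⋃ n : ℕ, Ioc (1 / ((n:ℝ) + 1)) (n + 2) := by
    intro x hx
    obtain ⟨n, hn⟩ := exists_nat_one_div_lt (mem_Ioi.1 hx)
    obtain ⟨m, hm⟩ := exists_nat_ge x
    refine mem_iUnion.2 ⟨max n m, ?_, ?_⟩
    · refine lt_of_le_of_lt (one_div_le_one_div_of_le (by positivity) ?_) hn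
      gcongr; exact le_max_left _ _
    · have : (m:ℝ) ≤ ((max n m : ℕ) : ℝ) := by exact_mod_cast le_max_right _ _
      linarith
  refine AEStronglyMeasurable.mono_set hs ?_
  refine aestronglyMeasurable_iUnion_iff.2 fun n => (hu.1 _ _ (by positivity) ?_).1
  have : 1 / ((n:ℝ) + 1) ≤ 1 := by
    rw [div_le_one (by positivity)]; linarith [n.cast_nonneg (α := ℝ)]
  linarith [n.cast_nonneg (α := ℝ)]

/-- Hölder's inequality for the derivative near the origin. -/
lemma MemD.integrableOn_and_integral_abs_le (hp : 1 < p) (hω : IsWeight ω) (hB : Bp0 p ω)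
    (hu : MemD p ω u u') (t : ℝ) :
    IntegrableOn u' (Ioc 0 t) ∧
      ∫ τ in Ioc (0:ℝ) t, |u' τ| ≤
        (∫ τ in Ioc (0:ℝ) t, |u' τ| ^ p * ω τ) ^ (1 / p) * Omega0 p ω t := by
  have hp0 : 0 < p := by linarith
  have hp1 : 0 < p - 1 := by linarith
  have hpq : p.HolderConjugate (p / (p - 1)) := Real.HolderConjugate.conjExponent hp
  have hq0 : 0 < p / (p - 1) := by positivity
  have hq : 1 / (p / (p - 1)) = 1 - 1 / p := by field_simp
  have hsub : Ioc (0:ℝ) t ⊆ Ioi 0 := fun x hx => hx.1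
  have hum : AEStronglyMeasurable u' (volume.restrict (Ioc 0 t)) :=
    hu.aestronglyMeasurable.mono_set hsub
  have hpow (r : ℝ) : AEStronglyMeasurable (fun τ => ω τ ^ r) (volume.restrict (Ioc 0 t)) :=
    ((hω.1.mono hsub).rpow_const
      fun x hx => Or.inl (hω.2 x hx.1).ne').aestronglyMeasurable measurableSet_Ioc
  have hfm : AEStronglyMeasurable (fun τ => |u' τ| * ω τ ^ (1 / p))
      (volume.restrict (Ioc 0 t)) := hum.norm.mul (hpow _)
  have hf0 : ∀ τ ∈ Ioc 0 t, 0 ≤ |u' τ| * ω τ ^ (1 / p) := fun τ hτ =>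
    mul_nonneg (abs_nonneg _) (Real.rpow_nonneg (hω.2 τ hτ.1).le _)
  have hg0 : ∀ τ ∈ Ioc 0 t, 0 ≤ ω τ ^ (-1 / p) := fun τ hτ =>
    Real.rpow_nonneg (hω.2 τ hτ.1).le _
  have hfp : EqOn (fun τ => (|u' τ| * ω τ ^ (1 / p)) ^ p) (fun τ => |u' τ| ^ p * ω τ)
      (Ioc 0 t) := fun τ hτ => by
    have h := (hω.2 τ hτ.1).le
    simp only
    rw [Real.mul_rpow (abs_nonneg _) (Real.rpow_nonneg h _), ← Real.rpow_mul h,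
      one_div_mul_cancel hp0.ne', Real.rpow_one]
  have hgq : EqOn (fun τ => (ω τ ^ (-1 / p)) ^ (p / (p - 1))) (fun τ => ω τ ^ (-1 / (p - 1)))
      (Ioc 0 t) := fun τ hτ => by
    simp only
    rw [← Real.rpow_mul (hω.2 τ hτ.1).le]
    congr 1
    field_simp
  have hfg : EqOn (fun τ => (|u' τ| * ω τ ^ (1 / p)) * ω τ ^ (-1 / p)) (fun τ => |u' τ|)
      (Ioc 0 t) := fun τ hτ => by
    have h := hω.2 τ hτ.1
    simp only
    rw [mul_assoc, ← Real.rpow_add h, ← add_div]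
    simp
  have hfL : MemLp (fun τ => |u' τ| * ω τ ^ (1 / p)) (ENNReal.ofReal p)
      (volume.restrict (Ioc 0 t)) := by
    rw [← integrable_norm_rpow_iff hfm (by simpa using hp0) ENNReal.ofReal_ne_top,
      ENNReal.toReal_ofReal hp0.le]
    refine ((hu.2.2.mono_set hsub).congr_fun hfp.symm measurableSet_Ioc).congr_fun
      (fun τ hτ => ?_) measurableSet_Ioc
    simp only [Real.norm_of_nonneg (hf0 τ hτ)]
  have hgL : MemLp (fun τ => ω τ ^ (-1 / p)) (ENNReal.ofReal (p / (p - 1)))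
      (volume.restrict (Ioc 0 t)) := by
    rw [← integrable_norm_rpow_iff (hpow _) (by simpa using hq0) ENNReal.ofReal_ne_top,
      ENNReal.toReal_ofReal hq0.le]
    refine ((hω.integrableOn_rpow hB t).congr_fun hgq.symm measurableSet_Ioc).congr_fun
      (fun τ hτ => ?_) measurableSet_Ioc
    simp only [Real.norm_of_nonneg (hg0 τ hτ)]
  constructor
  · have : ENNReal.HolderConjugate (ENNReal.ofReal p) (ENNReal.ofReal (p / (p - 1))) :=
      hpq.ennrealOfReal
    have h : IntegrableOn (fun τ => |u' τ|) (Ioc 0 t) :=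
      IntegrableOn.congr_fun (hfL.integrable_mul hgL) hfg measurableSet_Ioc
    exact (integrable_norm_iff hum).1 h
  · have h := integral_mul_le_Lp_mul_Lq_of_nonneg hpq
      ((ae_restrict_iff' measurableSet_Ioc).2 (.of_forall hf0))
      ((ae_restrict_iff' measurableSet_Ioc).2 (.of_forall hg0)) hfL hgL
    rwa [setIntegral_congr_fun measurableSet_Ioc hfg, setIntegral_congr_fun measurableSet_Ioc hfp,
      setIntegral_congr_fun measurableSet_Ioc hgq, hq] at h

lemma MemD.memR0 (hp : 1 < p) (hω : IsWeight ω) (hB : Bp0 p ω) (hu : MemD p ω u u') :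
    MemR0 p ω (u 1 - ∫ τ in Ioc (0:ℝ) 1, u' τ) u u' := by
  have hi (t : ℝ) := (hu.integrableOn_and_integral_abs_le hp hω hB t).1
  have key {a b : ℝ} (ha : 0 < a) (hab : a < b) :
      u b - u a = (∫ τ in Ioc 0 b, u' τ) - ∫ τ in Ioc 0 a, u' τ := by
    rw [hu.2.1 a b ha hab, ← intervalIntegral.integral_of_le ha.le,
      ← intervalIntegral.integral_of_le (ha.trans hab).le, intervalIntegral.integral_interval_sub_left]
    · exact (intervalIntegrable_iff_integrableOn_Ioc_of_le (ha.trans hab).le).2 (hi b)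
    · exact (intervalIntegrable_iff_integrableOn_Ioc_of_le ha.le).2 (hi a)
  refine ⟨hu, fun t ht => ⟨hi t, ?_⟩⟩
  rcases lt_trichotomy t 1 with h | rfl | h
  · linarith [key ht h]
  · ring
  · linarith [key one_pos h]

lemma MemR0.tendsto (h : MemR0 p ω c u u') : Tendsto u (𝓝[>] 0) (𝓝 c) := by
  have h1 := (tendsto_setIntegral_Ioc_zero (h.2 1 one_pos).1).const_add c
  rw [add_zero] at h1
  refine h1.congr' ?_
  filter_upwards [self_mem_nhdsWithin] with t ht using ((h.2 t ht).2).symm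

lemma MemR0.abs_sub_div_Omega0_le (hp : 1 < p) (hω : IsWeight ω) (hB : Bp0 p ω)
    (h : MemR0 p ω c u u') {t : ℝ} (ht : 0 < t) :
    |(u t - c) / Omega0 p ω t| ≤ (∫ τ in Ioc (0:ℝ) t, |u' τ| ^ p * ω τ) ^ (1 / p) := by
  have hpos := hω.Omega0_pos hB ht
  rw [abs_div, abs_of_pos hpos, div_le_iff₀ hpos, (h.2 t ht).2, add_sub_cancel_left]
  exact (abs_integral_le_integral_abs).trans
    (h.1.integrableOn_and_integral_abs_le hp hω hB t).2

lemma MemR0.tendsto_div_Omega0 (hp : 1 < p) (hω : IsWeight ω) (hB : Bp0 p ω)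
    (h : MemR0 p ω c u u') :
    Tendsto (fun t => (u t - c) / Omega0 p ω t) (𝓝[>] 0) (𝓝 0) := by
  have hp' : 0 < 1 / p := by positivity
  have h1 := (tendsto_setIntegral_Ioc_zero (h.1.2.2.mono_set fun x hx => hx.1)).rpow_const
    (p := 1 / p) (Or.inr hp'.le)
  rw [Real.zero_rpow hp'.ne'] at h1
  refine squeeze_zero_norm' ?_ h1
  filter_upwards [self_mem_nhdsWithin] with t ht using h.abs_sub_div_Omega0_le hp hω hB ht

lemma MemR0.div_Omega0_le (hp : 1 < p) (hω : IsWeight ω) (hB : Bp0 p ω)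
    (h : MemR0 p ω c u u') {t : ℝ} (ht : 0 < t) :
    (u t - c) / Omega0 p ω t ≤ dNorm p ω u' := by
  have h0 : ∀ τ ∈ Ioi (0:ℝ), 0 ≤ |u' τ| ^ p * ω τ := fun τ hτ =>
    mul_nonneg (by positivity) (hω.2 τ hτ).le
  refine (le_abs_self _).trans ((h.abs_sub_div_Omega0_le hp hω hB ht).trans ?_)
  refine Real.rpow_le_rpow ?_ ?_ (by positivity)
  · exact setIntegral_nonneg measurableSet_Ioc fun τ hτ => h0 τ hτ.1
  · exact setIntegral_mono_set h.1.2.2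
      ((ae_restrict_iff' measurableSet_Ioi).2 (.of_forall h0))
      (Eventually.of_forall fun x hx => hx.1)

lemma tendsto_of_tendsto_div_Omega0 (hp : 1 < p) (hω : IsWeight ω) (hB : Bp0 p ω)
    (h : Tendsto (fun t => (u t - c) / Omega0 p ω t) (𝓝[>] 0) (𝓝 0)) :
    Tendsto u (𝓝[>] 0) (𝓝 c) := by
  have h1 := (h.mul (tendsto_Omega0_zero hp hB)).add_const c
  rw [mul_zero, zero_add] at h1
  refine h1.congr' ?_
  filter_upwards [self_mem_nhdsWithin] with t ht
  rw [div_mul_cancel₀ _ (hω.Omega0_pos hB ht).ne', sub_add_cancel]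

end

/-- for `ω ∈ B_p(0)` and `u ∈ D^{1,p}(ℝ₊,ω)` the four conditions
(a) some sequence `t_n ↓ 0` with `u(t_n) → c`;
(b) `lim_{t→0⁺} u(t) = c`;
(c) `(u(t)-c)/Ω^0_ω(t) → 0` as `t → 0⁺` and `sup_{t>0}(u(t)-c)/Ω^0_ω(t) < ∞`;
(d) `u ∈ R^0_{p,ω}(c)`
are equivalent. -/
theorem stmt3 (p : ℝ) (ω : ℝ → ℝ) (hp : 1 < p) (hω : IsWeight ω)
    (hB : Bp0 p ω) (u u' : ℝ → ℝ) (hu : MemD p ω u u') (c : ℝ) :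
    ((∃ t : ℕ → ℝ, (∀ n, 0 < t n) ∧ StrictAnti t ∧ Tendsto t atTop (𝓝 0) ∧
        Tendsto (fun n => u (t n)) atTop (𝓝 c)) ↔
      Tendsto u (𝓝[>] 0) (𝓝 c)) ∧
    (Tendsto u (𝓝[>] 0) (𝓝 c) ↔
      (Tendsto (fun t => (u t - c) / Omega0 p ω t) (𝓝[>] 0) (𝓝 0) ∧
        ∃ M : ℝ, ∀ t : ℝ, 0 < t → (u t - c) / Omega0 p ω t ≤ M)) ∧
    ((Tendsto (fun t => (u t - c) / Omega0 p ω t) (𝓝[>] 0) (𝓝 0) ∧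
        ∃ M : ℝ, ∀ t : ℝ, 0 < t → (u t - c) / Omega0 p ω t ≤ M) ↔
      MemR0 p ω c u u') := by
  have hL := hu.memR0 hp hω hB
  have hlim := hL.tendsto
  have hbd : Tendsto u (𝓝[>] 0) (𝓝 c) → MemR0 p ω c u u' := fun h =>
    tendsto_nhds_unique hlim h ▸ hL
  have hcb := fun h => tendsto_of_tendsto_div_Omega0 (u := u) (c := c) hp hω hB h
  have hdc (h : MemR0 p ω c u u') : Tendsto (fun t => (u t - c) / Omega0 p ω t) (𝓝[>] 0) (𝓝 0) ∧
      ∃ M : ℝ, ∀ t : ℝ, 0 < t → (u t - c) / Omega0 p ω t ≤ M :=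
    ⟨h.tendsto_div_Omega0 hp hω hB, _, fun _ ht => h.div_Omega0_le hp hω hB ht⟩
  refine ⟨⟨?_, fun h => ?_⟩, ⟨fun h => hdc (hbd h), fun h => hcb h.1⟩,
    fun h => hbd (hcb h.1), hdc⟩
  · rintro ⟨t, ht, -, ht0, hut⟩
    have h := hlim.comp (tendsto_nhdsWithin_iff.2 ⟨ht0, .of_forall ht⟩)
    exact tendsto_nhds_unique h hut ▸ hlim
  · have ht : Tendsto (fun n : ℕ => 1 / ((n:ℝ) + 1)) atTop (𝓝 0) :=
      tendsto_one_div_add_atTop_nhds_zero_nat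
    refine ⟨fun n => 1 / ((n:ℝ) + 1), fun n => by positivity, fun m n hmn => ?_, ht,
      h.comp (tendsto_nhdsWithin_iff.2
        ⟨ht, .of_forall fun n => by simp only [mem_Ioi]; positivity⟩)⟩
    exact one_div_lt_one_div_of_lt (by positivity) (by gcongr)

end
end

section
/- Let ω be a weight on ℝ₊ with ω ∈ B_p(∞) and 1 < p < ∞. Then D_0^{1,p}(ℝ₊,ω) = R^∞_{p,ω}(0) if and only if ω ∉ B_p(0). -/
open MeasureTheory Set Filter Topology
open scoped NNReal ENNReal

noncomputable section

/-- The weighted energy `∫_0^∞ |g|^p ω`. -/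
def energy (p : ℝ) (ω g : ℝ → ℝ) : ℝ :=
  ∫ t in Set.Ioi (0:ℝ), |g t| ^ p * ω t

/-- Membership in the weighted Lebesgue space `L^p(ℝ₊, ω)`. -/
def FiniteEnergy (p : ℝ) (ω g : ℝ → ℝ) : Prop :=
  AEStronglyMeasurable g (volume.restrict (Set.Ioi 0)) ∧
  IntegrableOn (fun t => |g t| ^ p * ω t) (Set.Ioi 0)

/-- Smooth functions with compact support in `(0,∞)`. -/
def IsTest (f : ℝ → ℝ) : Prop :=
  ContDiff ℝ (⊤ : ℕ∞) f ∧ HasCompactSupport f ∧ tsupport f ⊆ Set.Ioi 0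

theorem abs_add_rpow_le {p : ℝ} (hp : 0 ≤ p) (a b : ℝ) :
    |a + b| ^ p ≤ 2 ^ p * (|a| ^ p + |b| ^ p) := by
  have h1 : |a + b| ≤ 2 * max |a| |b| := by
    have := abs_add_le a b
    have := le_max_left |a| |b|
    have := le_max_right |a| |b|
    linarith
  have h2 : (max |a| |b|) ^ p ≤ |a| ^ p + |b| ^ p := by
    have ha := Real.rpow_nonneg (abs_nonneg a) p
    have hb := Real.rpow_nonneg (abs_nonneg b) p
    rcases max_cases |a| |b| with h | h <;> rw [h.1] <;> linarith
  calc |a + b| ^ p ≤ (2 * max |a| |b|) ^ p := Real.rpow_le_rpow (abs_nonneg _) h1 hp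
    _ = 2 ^ p * (max |a| |b|) ^ p := Real.mul_rpow (by norm_num) (by positivity)
    _ ≤ _ := by gcongr

theorem IsWeight.aestronglyMeasurable {ω : ℝ → ℝ} (hω : IsWeight ω) :
    AEStronglyMeasurable ω (volume.restrict (Set.Ioi 0)) :=
  hω.1.aestronglyMeasurable measurableSet_Ioi

theorem IsWeight.continuousOn_rpow {ω : ℝ → ℝ} (hω : IsWeight ω) (s : ℝ) :
    ContinuousOn (fun t => ω t ^ s) (Set.Ioi 0) :=
  hω.1.rpow_const fun t ht => Or.inl (hω.2 t ht).ne'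

theorem energy_nonneg {p : ℝ} {ω : ℝ → ℝ} (hω : IsWeight ω) (g : ℝ → ℝ) : 0 ≤ energy p ω g :=
  setIntegral_nonneg measurableSet_Ioi fun t ht =>
    mul_nonneg (Real.rpow_nonneg (abs_nonneg _) _) (hω.2 t ht).le

theorem FiniteEnergy.of_le {p : ℝ} {ω f : ℝ → ℝ} (hω : IsWeight ω)
    (hf : AEStronglyMeasurable f (volume.restrict (Set.Ioi 0)))
    {h : ℝ → ℝ} (hh : IntegrableOn h (Set.Ioi 0))
    (hfg : ∀ t : ℝ, 0 < t → |f t| ^ p * ω t ≤ h t) :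
    FiniteEnergy p ω f := by
  refine ⟨hf, Integrable.mono' hh ?_ ?_⟩
  · have : AEMeasurable (fun t => |f t| ^ p * ω t) (volume.restrict (Set.Ioi 0)) :=
      ((hf.aemeasurable.abs).pow_const p).mul hω.aestronglyMeasurable.aemeasurable
    exact this.aestronglyMeasurable
  · filter_upwards [ae_restrict_mem measurableSet_Ioi] with t ht
    rw [Real.norm_of_nonneg (mul_nonneg (Real.rpow_nonneg (abs_nonneg _) _) (hω.2 t ht).le)]
    exact hfg t ht

theorem FiniteEnergy.add {p : ℝ} {ω f g : ℝ → ℝ} (hp : 0 ≤ p) (hω : IsWeight ω)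
    (hf : FiniteEnergy p ω f) (hg : FiniteEnergy p ω g) :
    FiniteEnergy p ω (fun t => f t + g t) ∧
      energy p ω (fun t => f t + g t) ≤ 2 ^ p * (energy p ω f + energy p ω g) := by
  have hle : ∀ t : ℝ, 0 < t → |f t + g t| ^ p * ω t ≤
      2 ^ p * (|f t| ^ p * ω t + |g t| ^ p * ω t) := fun t ht => by
    have := mul_le_mul_of_nonneg_right (abs_add_rpow_le hp (f t) (g t)) (hω.2 t ht).le
    linarith
  have hint : IntegrableOn (fun t => 2 ^ p * (|f t| ^ p * ω t + |g t| ^ p * ω t)) (Set.Ioi 0) :=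
    (hf.2.add hg.2).const_mul _
  have hfe : FiniteEnergy p ω (fun t => f t + g t) :=
    FiniteEnergy.of_le hω (hf.1.add hg.1) hint hle
  refine ⟨hfe, ?_⟩
  calc energy p ω (fun t => f t + g t)
      ≤ ∫ t in Set.Ioi (0:ℝ), 2 ^ p * (|f t| ^ p * ω t + |g t| ^ p * ω t) :=
        setIntegral_mono_on hfe.2 hint measurableSet_Ioi hle
    _ = _ := by rw [integral_const_mul, integral_add hf.2 hg.2]; rfl

theorem FiniteEnergy.neg {p : ℝ} {ω g : ℝ → ℝ} (hg : FiniteEnergy p ω g) :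
    FiniteEnergy p ω (fun t => -g t) :=
  ⟨hg.1.neg, by simpa only [abs_neg] using hg.2⟩

theorem energy_neg {p : ℝ} {ω g : ℝ → ℝ} : energy p ω (fun t => -g t) = energy p ω g := by
  simp [energy]

theorem FiniteEnergy.sub {p : ℝ} {ω f g : ℝ → ℝ} (hp : 0 ≤ p) (hω : IsWeight ω)
    (hf : FiniteEnergy p ω f) (hg : FiniteEnergy p ω g) :
    FiniteEnergy p ω (fun t => f t - g t) ∧
      energy p ω (fun t => f t - g t) ≤ 2 ^ p * (energy p ω f + energy p ω g) := by
  simpa only [sub_eq_add_neg, energy_neg] using hf.add hp hω hg.neg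

theorem FiniteEnergy.memLp {p : ℝ} {ω g : ℝ → ℝ} (hp : 1 < p) (hω : IsWeight ω)
    (hg : FiniteEnergy p ω g) :
    MemLp (fun t => g t * ω t ^ (1 / p)) (ENNReal.ofReal p) (volume.restrict (Set.Ioi 0)) := by
  have hp0 : 0 < p := by linarith
  have hm : AEStronglyMeasurable (fun t => g t * ω t ^ (1 / p)) (volume.restrict (Set.Ioi 0)) :=
    hg.1.mul ((hω.continuousOn_rpow _).aestronglyMeasurable measurableSet_Ioi)
  rw [← integrable_norm_rpow_iff hm (by simpa using hp0) ENNReal.ofReal_ne_top,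
    ENNReal.toReal_ofReal hp0.le]
  refine hg.2.congr_fun (fun t ht => ?_) measurableSet_Ioi
  have hωt := hω.2 t ht
  simp only [norm_mul, Real.norm_eq_abs]
  rw [Real.mul_rpow (abs_nonneg _) (abs_nonneg _), abs_of_nonneg (Real.rpow_nonneg hωt.le _),
    ← Real.rpow_mul hωt.le, one_div_mul_cancel hp0.ne', Real.rpow_one]

theorem norm_mul_rpow_rpow {p : ℝ} (hp : 0 < p) {x y : ℝ} (hy : 0 ≤ y) :
    ‖x * y ^ (1 / p)‖ ^ p = |x| ^ p * y := by
  rw [norm_mul, Real.norm_eq_abs, Real.norm_eq_abs, Real.mul_rpow (abs_nonneg _) (abs_nonneg _),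
    abs_of_nonneg (Real.rpow_nonneg hy _), ← Real.rpow_mul hy, one_div_mul_cancel hp.ne',
    Real.rpow_one]

/-- Hölder's inequality for the weight and its dual weight. -/
theorem FiniteEnergy.integrableOn_and_abs_integral_le {p : ℝ} {ω g : ℝ → ℝ} (hp : 1 < p)
    (hω : IsWeight ω) (hg : FiniteEnergy p ω g) {S : Set ℝ} (hS : MeasurableSet S)
    (hS0 : S ⊆ Set.Ioi 0) (hw : IntegrableOn (fun t => ω t ^ (-1 / (p - 1))) S) :
    IntegrableOn g S ∧ |∫ t in S, g t| ≤
      energy p ω g ^ (1 / p) * (∫ t in S, ω t ^ (-1 / (p - 1))) ^ (1 - 1 / p) := by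
  have hp0 : 0 < p := by linarith
  have hpq : p.HolderConjugate (p / (p - 1)) := Real.HolderConjugate.conjExponent hp
  have hq0 := hpq.symm.pos
  have h1 : MemLp (fun t => g t * ω t ^ (1 / p)) (ENNReal.ofReal p) (volume.restrict S) :=
    (hg.memLp hp hω).mono_measure (Measure.restrict_mono hS0 le_rfl)
  have hpow : ∀ t ∈ S, ‖ω t ^ (-(1 / p))‖ ^ (p / (p - 1)) = ω t ^ (-1 / (p - 1)) := fun t ht => by
    have hωt := hω.2 t (hS0 ht)
    rw [Real.norm_of_nonneg (Real.rpow_nonneg hωt.le _), ← Real.rpow_mul hωt.le]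
    congr 1
    have : p - 1 ≠ 0 := by linarith
    field_simp
  have h2 : MemLp (fun t => ω t ^ (-(1 / p))) (ENNReal.ofReal (p / (p - 1)))
      (volume.restrict S) := by
    have hm : AEStronglyMeasurable (fun t => ω t ^ (-(1 / p))) (volume.restrict S) :=
      ((hω.continuousOn_rpow _).mono hS0).aestronglyMeasurable hS
    rw [← integrable_norm_rpow_iff hm (by simpa using hq0) ENNReal.ofReal_ne_top,
      ENNReal.toReal_ofReal hq0.le]
    exact hw.congr_fun (fun t ht => (hpow t ht).symm) hS
  have hmul : ∀ t ∈ S, g t * ω t ^ (1 / p) * ω t ^ (-(1 / p)) = g t := fun t ht => by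
    have hωt := hω.2 t (hS0 ht)
    rw [mul_assoc, ← Real.rpow_add hωt]
    simp
  have hint : IntegrableOn g S := by
    have : (ENNReal.ofReal p).HolderTriple (ENNReal.ofReal (p / (p - 1))) 1 :=
      hpq.ennrealOfReal
    exact IntegrableOn.congr_fun (MemLp.integrable_mul h1 h2) hmul hS
  refine ⟨hint, ?_⟩
  have key := integral_mul_norm_le_Lp_mul_Lq hpq h1 h2
  have e1 : ∫ t in S, ‖g t * ω t ^ (1 / p)‖ * ‖ω t ^ (-(1 / p))‖ = ∫ t in S, ‖g t‖ :=
    setIntegral_congr_fun hS fun t ht => by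
      rw [← norm_mul, hmul t ht]
  have e2 : ∫ t in S, ‖g t * ω t ^ (1 / p)‖ ^ p ≤ energy p ω g := by
    rw [setIntegral_congr_fun (g := fun t => |g t| ^ p * ω t) hS fun t ht =>
      norm_mul_rpow_rpow hp0 (hω.2 t (hS0 ht)).le]
    refine setIntegral_mono_set hg.2 ?_ (LE.le.eventuallyLE hS0)
    filter_upwards [ae_restrict_mem measurableSet_Ioi] with t ht
    exact mul_nonneg (Real.rpow_nonneg (abs_nonneg _) _) (hω.2 t ht).le
  have e3 : ∫ t in S, ‖ω t ^ (-(1 / p))‖ ^ (p / (p - 1)) = ∫ t in S, ω t ^ (-1 / (p - 1)) :=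
    setIntegral_congr_fun hS hpow
  have e4 : 1 / (p / (p - 1)) = 1 - 1 / p := by
    have : p - 1 ≠ 0 := by linarith
    field_simp
  rw [e1, e3, e4] at key
  calc |∫ t in S, g t| ≤ ∫ t in S, ‖g t‖ := norm_integral_le_integral_norm (f := g) (μ := volume.restrict S)
    _ ≤ _ := key
    _ ≤ _ := by
      have hn : 0 ≤ ∫ t in S, ω t ^ (-1 / (p - 1)) :=
        setIntegral_nonneg hS fun t ht => Real.rpow_nonneg (hω.2 t (hS0 ht)).le _
      gcongr

theorem MemD.finiteEnergy {p : ℝ} {ω u u' : ℝ → ℝ} (h : MemD p ω u u') :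
    FiniteEnergy p ω u' := by
  refine ⟨?_, h.2.2⟩
  have hU : Set.Ioi (0:ℝ) = ⋃ n : ℕ, Set.Ioc (1 / ((n:ℝ) + 2)) (n + 2) := by
    ext t
    simp only [Set.mem_Ioi, Set.mem_iUnion, Set.mem_Ioc]
    constructor
    · intro ht
      obtain ⟨n, hn⟩ := exists_nat_gt (max t (1 / t))
      have h1 : t < n := lt_of_le_of_lt (le_max_left _ _) hn
      have h2 : 1 / t < n := lt_of_le_of_lt (le_max_right _ _) hn
      refine ⟨n, ?_, by linarith⟩
      rw [div_lt_iff₀ ht] at h2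
      rw [div_lt_iff₀ (by positivity)]
      nlinarith
    · rintro ⟨n, hn, -⟩
      exact lt_trans (by positivity) hn
  rw [hU, aestronglyMeasurable_iUnion_iff]
  intro n
  refine (h.1 _ _ (by positivity) ?_).aestronglyMeasurable
  rw [div_lt_iff₀ (by positivity)]
  nlinarith [(Nat.cast_nonneg n : (0:ℝ) ≤ n)]

theorem finiteEnergy_of_continuous {p : ℝ} {ω g : ℝ → ℝ} (hp : 0 < p) (hω : IsWeight ω)
    (hg : Continuous g) (hc : HasCompactSupport g) (hs : tsupport g ⊆ Set.Ioi 0) :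
    FiniteEnergy p ω g := by
  refine ⟨hg.aestronglyMeasurable, Integrable.integrableOn ?_⟩
  rw [← integrableOn_iff_integrable_of_support_subset (s := tsupport g)]
  · refine ContinuousOn.integrableOn_compact hc ?_
    exact ((hg.abs.rpow_const fun _ => Or.inr hp.le).continuousOn).mul (hω.1.mono hs)
  · intro t ht
    apply subset_tsupport
    intro h0
    apply ht
    simp [h0, Real.zero_rpow hp.ne']

theorem IsTest.finiteEnergy {p : ℝ} {ω g : ℝ → ℝ} (hp : 0 < p) (hω : IsWeight ω)
    (hg : IsTest g) : FiniteEnergy p ω g :=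
  finiteEnergy_of_continuous hp hω hg.1.continuous hg.2.1 hg.2.2

theorem IsTest.integrable {g : ℝ → ℝ} (hg : IsTest g) : Integrable g :=
  hg.1.continuous.integrable_of_hasCompactSupport hg.2.1

theorem IsTest.sub {f g : ℝ → ℝ} (hf : IsTest f) (hg : IsTest g) :
    IsTest (fun t => f t - g t) := by
  refine ⟨hf.1.sub hg.1, hf.2.1.sub hg.2.1, ?_⟩
  exact (tsupport_sub f g).trans (Set.union_subset hf.2.2 hg.2.2)

theorem IsTest.mul_left {χ f : ℝ → ℝ} (hχ : IsTest χ) (hf : ContDiff ℝ (⊤ : ℕ∞) f) :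
    IsTest (fun t => χ t * f t) :=
  ⟨hχ.1.mul hf, hχ.2.1.mul_right, (tsupport_mul_subset_left (f := χ) (g := f)).trans hχ.2.2⟩

theorem IsTest.isTest_deriv {f : ℝ → ℝ} (hf : IsTest f) : IsTest (deriv f) :=
  ⟨(contDiff_infty_iff_deriv.1 hf.1).2, hf.2.1.deriv, (tsupport_deriv_subset).trans hf.2.2⟩

theorem exists_cutoff {a b : ℝ} (ha : 0 < a) (hab : a < b) :
    ∃ χ : ℝ → ℝ, IsTest χ ∧ (∀ t, 0 ≤ χ t) ∧ (∀ t, χ t ≤ 1) ∧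
      (∀ t ∈ Set.Icc a b, χ t = 1) ∧ tsupport χ ⊆ Set.Icc (a / 2) (b + a / 2) := by
  let χ : ContDiffBump ((a + b) / 2) := ⟨(b - a) / 2, b / 2, by linarith, by linarith⟩
  have hs : tsupport χ = Set.Icc (a / 2) (b + a / 2) := by
    rw [χ.tsupport_eq, Real.closedBall_eq_Icc]
    congr 1 <;> simp only [χ] <;> ring
  refine ⟨χ, ⟨χ.contDiff, χ.hasCompactSupport, ?_⟩, fun t => χ.nonneg, fun t => χ.le_one,
    fun t ht => χ.one_of_mem_closedBall ?_, hs.le⟩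
  · rw [hs]
    intro t ht
    have := ht.1
    simp only [Set.mem_Ioi]
    linarith
  · rw [Real.closedBall_eq_Icc]
    simp only [χ]
    constructor <;> linarith [ht.1, ht.2]

theorem IsTest.exists_tsupport_subset_Icc {f : ℝ → ℝ} (hf : IsTest f) :
    ∃ a b : ℝ, 0 < a ∧ a < b ∧ tsupport f ⊆ Set.Icc a b := by
  have hc : IsCompact (tsupport f) := hf.2.1
  rcases (tsupport f).eq_empty_or_nonempty with he | hne
  · exact ⟨1, 2, one_pos, one_lt_two, by simp [he]⟩
  · obtain ⟨a, ha, hamin⟩ := hc.exists_isLeast hne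
    obtain ⟨b, hb, hbmax⟩ := hc.exists_isGreatest hne
    exact ⟨a, b + 1, hf.2.2 ha, by linarith [hamin hb],
      fun t ht => ⟨hamin ht, by linarith [hbmax ht]⟩⟩

theorem FiniteEnergy.sub_trans {p : ℝ} {ω f g h : ℝ → ℝ} (hp : 0 ≤ p) (hω : IsWeight ω)
    (hf : FiniteEnergy p ω f) (hg : FiniteEnergy p ω g) (hh : FiniteEnergy p ω h) :
    energy p ω (fun t => f t - h t) ≤
      2 ^ p * (energy p ω (fun t => f t - g t) + energy p ω (fun t => g t - h t)) := by
  have := ((hf.sub hp hω hg).1.add hp hω (hg.sub hp hω hh).1).2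
  simpa only [sub_add_sub_cancel] using this

theorem FiniteEnergy.exists_continuousOn {p : ℝ} {ω g : ℝ → ℝ} (hp : 1 < p) (hω : IsWeight ω)
    (hg : FiniteEnergy p ω g) {ε : ℝ} (hε : 0 < ε) :
    ∃ h : ℝ → ℝ, ContinuousOn h (Set.Ioi 0) ∧ FiniteEnergy p ω h ∧
      energy p ω (fun t => h t - g t) ≤ ε := by
  have hp0 : 0 < p := by linarith
  obtain ⟨h, -, hle, hcont, hLp⟩ :=
    (hg.memLp hp hω).exists_hasCompactSupport_integral_rpow_sub_le hp0 hε
  have hc : ContinuousOn (fun t => h t * ω t ^ (-(1 / p))) (Set.Ioi 0) :=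
    hcont.continuousOn.mul (hω.continuousOn_rpow _)
  have hcancel : ∀ t : ℝ, 0 < t → h t * ω t ^ (-(1 / p)) * ω t ^ (1 / p) = h t := fun t ht => by
    rw [mul_assoc, ← Real.rpow_add (hω.2 t ht)]
    simp
  refine ⟨_, hc, ⟨hc.aestronglyMeasurable measurableSet_Ioi, ?_⟩, ?_⟩
  · have := hLp.integrable_norm_rpow (by simpa using hp0) ENNReal.ofReal_ne_top
    rw [ENNReal.toReal_ofReal hp0.le] at this
    refine IntegrableOn.congr_fun this (fun t ht => ?_) measurableSet_Ioi
    simp only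
    rw [← norm_mul_rpow_rpow hp0 (hω.2 t ht).le, hcancel t ht]
  · refine le_of_eq_of_le (setIntegral_congr_fun measurableSet_Ioi fun t ht => ?_) hle
    simp only
    rw [← norm_mul_rpow_rpow hp0 (hω.2 t ht).le, sub_mul, hcancel t ht, norm_sub_rev]

theorem FiniteEnergy.cutoff {p : ℝ} {ω g χ : ℝ → ℝ} (hp : 0 ≤ p) (hω : IsWeight ω)
    (hg : FiniteEnergy p ω g) (hχ : Continuous χ) (h1 : ∀ t, |χ t| ≤ 1) :
    FiniteEnergy p ω (fun t => χ t * g t) := by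
  refine FiniteEnergy.of_le hω (hχ.aestronglyMeasurable.mul hg.1) hg.2 fun t ht => ?_
  refine mul_le_mul_of_nonneg_right (Real.rpow_le_rpow (abs_nonneg _) ?_ hp) (hω.2 t ht).le
  rw [abs_mul]
  exact mul_le_of_le_one_left (abs_nonneg _) (h1 t)

theorem FiniteEnergy.exists_cutoff {p : ℝ} {ω g : ℝ → ℝ} (hp : 0 < p) (hω : IsWeight ω)
    (hg : FiniteEnergy p ω g) {ε : ℝ} (hε : 0 < ε) :
    ∃ χ : ℝ → ℝ, IsTest χ ∧ (∀ t, |χ t| ≤ 1) ∧ energy p ω (fun t => χ t * g t - g t) < ε := by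
  have hlt : ∀ n : ℕ, 1 / ((n:ℝ) + 2) < n + 2 := fun n => by
    rw [div_lt_iff₀ (by positivity)]
    nlinarith [(Nat.cast_nonneg n : (0:ℝ) ≤ n)]
  choose χ hχ h0 h1 hone _ using fun n : ℕ =>
    _root_.exists_cutoff (a := 1 / ((n:ℝ) + 2)) (by positivity) (hlt n)
  have habs : ∀ n t, |χ n t| ≤ 1 := fun n t => abs_le.2 ⟨by linarith [h0 n t], h1 n t⟩
  have hlim : Tendsto (fun n => energy p ω (fun t => χ n t * g t - g t)) atTop (𝓝 0) := by
    have hfe := fun n => ((hg.cutoff hp.le hω (hχ n).1.continuous (habs n)).sub hp.le hω hg).1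
    have := tendsto_integral_of_dominated_convergence
      (F := fun n t => |χ n t * g t - g t| ^ p * ω t) (f := fun _ => (0:ℝ))
      (μ := volume.restrict (Set.Ioi 0)) (fun t => |g t| ^ p * ω t)
      (fun n => (hfe n).2.aestronglyMeasurable) hg.2 ?_ ?_
    · simpa [energy] using this
    · intro n
      filter_upwards [ae_restrict_mem measurableSet_Ioi] with t ht
      rw [Real.norm_of_nonneg (mul_nonneg (Real.rpow_nonneg (abs_nonneg _) _) (hω.2 t ht).le)]
      refine mul_le_mul_of_nonneg_right (Real.rpow_le_rpow (abs_nonneg _) ?_ hp.le) (hω.2 t ht).le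
      rw [← sub_one_mul, abs_mul]
      refine mul_le_of_le_one_left (abs_nonneg _) (abs_le.2 ⟨?_, ?_⟩) <;>
        linarith [h0 n t, h1 n t]
    · filter_upwards [ae_restrict_mem measurableSet_Ioi] with t ht
      refine tendsto_const_nhds.congr' ?_
      filter_upwards [eventually_ge_atTop ⌈max t (1 / t)⌉₊] with n hn
      have hn' := Nat.ceil_le.1 hn
      have ht1 : t ≤ n := (le_max_left _ _).trans hn'
      have ht2 : 1 / t ≤ n := (le_max_right _ _).trans hn'
      rw [hone n t ⟨?_, by linarith⟩]
      · simp [Real.zero_rpow hp.ne']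
      · rw [div_le_iff₀ (by positivity)]
        rw [div_le_iff₀ ht] at ht2
        nlinarith [Set.mem_Ioi.1 ht]
  obtain ⟨n, hn⟩ := (hlim.eventually_lt_const hε).exists
  exact ⟨χ n, hχ n, habs n, hn⟩

theorem exists_test_near_cutoff_mul {p : ℝ} {ω h χ : ℝ → ℝ} (hp : 0 < p) (hω : IsWeight ω)
    (hh : ContinuousOn h (Set.Ioi 0)) (hχ : IsTest χ) (h1 : ∀ t, |χ t| ≤ 1)
    {ε : ℝ} (hε : 0 < ε) :
    ∃ f : ℝ → ℝ, IsTest f ∧ energy p ω (fun t => f t - χ t * h t) < ε := by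
  obtain ⟨a, b, ha, hab, hsupp⟩ := hχ.exists_tsupport_subset_Icc
  have hsub : Set.Icc a b ⊆ Set.Ioi 0 := fun t ht => lt_of_lt_of_le ha ht.1
  have hωint : IntegrableOn ω (Set.Icc a b) :=
    (hω.1.mono hsub).integrableOn_compact isCompact_Icc
  set M := ∫ t in Set.Icc a b, ω t with hM
  have hM0 : 0 ≤ M := setIntegral_nonneg measurableSet_Icc fun t ht => (hω.2 t (hsub ht)).le
  set η := (ε / (2 * (M + 1))) ^ (1 / p) with hη
  have hη0 : 0 < η := by positivity
  have hηp : η ^ p = ε / (2 * (M + 1)) := by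
    rw [hη, ← Real.rpow_mul (by positivity), one_div_mul_cancel hp.ne', Real.rpow_one]
  obtain ⟨q, hq⟩ := exists_polynomial_near_of_continuousOn a b h (hh.mono hsub) η hη0
  have hqs : ContDiff ℝ (⊤ : ℕ∞) (fun t => q.eval t) := by
    simpa using q.contDiff_aeval (𝕜 := ℝ) (n := (⊤ : ℕ∞))
  refine ⟨fun t => χ t * q.eval t, hχ.mul_left hqs, ?_⟩
  have hbound : IntegrableOn ((Set.Icc a b).indicator fun t => η ^ p * ω t) (Set.Ioi 0) :=
    ((integrable_indicator_iff measurableSet_Icc).2 (hωint.const_mul _)).integrableOn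
  have hle : ∀ t : ℝ, 0 < t → |χ t * q.eval t - χ t * h t| ^ p * ω t ≤
      (Set.Icc a b).indicator (fun t => η ^ p * ω t) t := by
    intro t ht
    by_cases hmem : t ∈ Set.Icc a b
    · rw [Set.indicator_of_mem hmem]
      refine mul_le_mul_of_nonneg_right (Real.rpow_le_rpow (abs_nonneg _) ?_ hp.le) (hω.2 t ht).le
      rw [← mul_sub, abs_mul]
      exact (mul_le_of_le_one_left (abs_nonneg _) (h1 t)).trans (hq t hmem).le
    · rw [Set.indicator_of_notMem hmem, image_eq_zero_of_notMem_tsupport fun h => hmem (hsupp h)]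
      simp [Real.zero_rpow hp.ne']
  have hmeas : AEStronglyMeasurable (fun t => χ t * q.eval t - χ t * h t)
      (volume.restrict (Set.Ioi 0)) :=
    ((hχ.1.mul hqs).continuous.continuousOn.sub
      (hχ.1.continuous.continuousOn.mul hh)).aestronglyMeasurable measurableSet_Ioi
  calc energy p ω (fun t => χ t * q.eval t - χ t * h t)
      ≤ ∫ t in Set.Ioi 0, (Set.Icc a b).indicator (fun t => η ^ p * ω t) t :=
        setIntegral_mono_on (FiniteEnergy.of_le hω hmeas hbound hle).2 hbound
          measurableSet_Ioi hle
    _ = ε / (2 * (M + 1)) * M := by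
        rw [setIntegral_indicator measurableSet_Icc, Set.inter_eq_right.2 hsub,
          integral_const_mul, hηp]
    _ < ε := by
        rw [div_mul_eq_mul_div, div_lt_iff₀ (by positivity)]
        nlinarith [mul_nonneg hε.le hM0]

/-- Test functions are dense in `L^p(ℝ₊, ω)`. -/
theorem FiniteEnergy.exists_test {p : ℝ} {ω g : ℝ → ℝ} (hp : 1 < p) (hω : IsWeight ω)
    (hg : FiniteEnergy p ω g) {ε : ℝ} (hε : 0 < ε) :
    ∃ f : ℝ → ℝ, IsTest f ∧ energy p ω (fun t => f t - g t) < ε := by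
  have hp0 : 0 < p := by linarith
  set C : ℝ := 2 ^ p with hC
  have hC0 : 0 < C := by positivity
  have hδ : 0 < ε / (4 * C * (C + 1)) := by positivity
  set δ := ε / (4 * C * (C + 1)) with hδdef
  obtain ⟨h, hcont, hh, hhg⟩ := hg.exists_continuousOn hp hω hδ
  obtain ⟨χ, hχ, h1, hχh⟩ := hh.exists_cutoff hp0 hω hδ
  obtain ⟨f, hf, hfχ⟩ := exists_test_near_cutoff_mul hp0 hω hcont hχ h1 hδ
  have hfe := hf.finiteEnergy hp0 hω
  have hχe := hh.cutoff hp0.le hω hχ.1.continuous h1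
  refine ⟨f, hf, ?_⟩
  have e1 := hfe.sub_trans hp0.le hω hχe hg
  have e2 := hχe.sub_trans hp0.le hω hh hg
  calc energy p ω (fun t => f t - g t)
      ≤ C * (δ + C * (δ + δ)) := by
        refine e1.trans ?_
        gcongr
        refine e2.trans ?_
        gcongr
    _ < C * (2 * (C + 1) * δ) := by nlinarith [mul_pos hC0 hδ]
    _ = ε / 2 := by rw [hδdef]; field_simp; norm_num
    _ < ε := by linarith

theorem abs_add_integral_Ioi_le {p : ℝ} {ω u' φ : ℝ → ℝ} (hp : 1 < p) (hω : IsWeight ω)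
    (hu : FiniteEnergy p ω u') (hφ : IsTest φ) {t : ℝ} (ht : 0 ≤ t)
    (hw : IntegrableOn (fun t => ω t ^ (-1 / (p - 1))) (Set.Ioi t)) :
    |φ t + ∫ τ in Set.Ioi t, u' τ| ≤ energy p ω (fun t => deriv φ t - u' t) ^ (1 / p) *
      (∫ τ in Set.Ioi t, ω τ ^ (-1 / (p - 1))) ^ (1 - 1 / p) := by
  have hp0 : 0 < p := by linarith
  have hsub : Set.Ioi t ⊆ Set.Ioi 0 := Set.Ioi_subset_Ioi ht
  have hd := hφ.isTest_deriv
  have hint := (hu.integrableOn_and_abs_integral_le hp hω measurableSet_Ioi hsub hw).1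
  have key := (((hd.finiteEnergy hp0 hω).sub hp0.le hω hu).1.integrableOn_and_abs_integral_le
    hp hω measurableSet_Ioi hsub hw).2
  rw [integral_sub hd.integrable.integrableOn hint,
    hφ.2.1.integral_Ioi_deriv_eq (hφ.1.of_le (by exact_mod_cast le_top)), ← abs_neg] at key
  convert key using 2
  ring

theorem IsTest.exists_deriv_eq {g : ℝ → ℝ} (hg : IsTest g) (h0 : ∫ t, g t = 0) :
    ∃ φ : ℝ → ℝ, IsTest φ ∧ deriv φ = g := by
  obtain ⟨a, b, ha, hab, hsupp⟩ := hg.exists_tsupport_subset_Icc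
  have hzero : ∀ t, t ∉ Set.Icc a b → g t = 0 := fun t ht =>
    image_eq_zero_of_notMem_tsupport fun h => ht (hsupp h)
  have hd : deriv (fun t => ∫ x in a..t, g x) = g :=
    funext fun t => Continuous.deriv_integral g hg.1.continuous a t
  have hs : Function.support (fun t => ∫ x in a..t, g x) ⊆ Set.Icc a b := by
    intro t ht
    by_contra hmem
    apply ht
    rcases lt_or_ge t a with hta | hta
    · simp only
      rw [intervalIntegral.integral_symm, intervalIntegral.integral_of_le hta.le,
        integral_Ioc_eq_integral_Ioo]
      rw [setIntegral_eq_zero_of_forall_eq_zero, neg_zero]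
      exact fun x hx => hzero x fun h => by linarith [hx.2, h.1]
    · have htb : b < t := by
        by_contra hb
        exact hmem ⟨hta, not_lt.1 hb⟩
      simp only
      rw [intervalIntegral.integral_of_le hta, ← integral_Icc_eq_integral_Ioc,
        setIntegral_eq_integral_of_forall_compl_eq_zero, h0]
      exact fun x hx => hzero x fun h => hx ⟨h.1, h.2.trans htb.le⟩
  have hts : tsupport (fun t => ∫ x in a..t, g x) ⊆ Set.Icc a b :=
    closure_minimal hs isClosed_Icc
  refine ⟨fun t => ∫ x in a..t, g x, ⟨?_, ?_, ?_⟩, hd⟩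
  · rw [contDiff_infty_iff_deriv, hd]
    refine ⟨fun t => ?_, hg.1⟩
    exact (hg.1.continuous.integral_hasStrictDerivAt a t).hasDerivAt.differentiableAt
  · exact isCompact_Icc.of_isClosed_subset (isClosed_tsupport _) hts
  · exact fun t ht => lt_of_lt_of_le ha (hts ht).1

theorem exists_lt_integral_of_not_Bp0 {p : ℝ} {ω : ℝ → ℝ} (hω : IsWeight ω) (h : ¬ Bp0 p ω)
    (R : ℝ) : ∃ δ : ℝ, 0 < δ ∧ δ < 1 ∧ R < ∫ t in Set.Ioc δ 1, ω t ^ (-1 / (p - 1)) := by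
  by_contra! hcon
  apply h
  have hpos : ∀ n : ℕ, (0:ℝ) < 1 / ((n:ℝ) + 2) := fun n => by positivity
  refine integrableOn_Ioc_of_intervalIntegral_norm_bounded_left (l := atTop) (I := R)
    (a := fun n : ℕ => 1 / ((n:ℝ) + 2)) (fun n => ?_) ?_ (Eventually.of_forall fun n => ?_)
  · refine (ContinuousOn.integrableOn_compact isCompact_Icc ?_).mono_set Set.Ioc_subset_Icc_self
    exact (hω.continuousOn_rpow _).mono fun t ht => (hpos n).trans_le ht.1
  · exact tendsto_const_nhds.div_atTop
      (tendsto_natCast_atTop_atTop.atTop_add tendsto_const_nhds)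
  · refine le_of_eq_of_le ?_ (hcon (1 / ((n:ℝ) + 2)) (hpos n) ?_)
    · refine setIntegral_congr_fun measurableSet_Ioc fun t ht => ?_
      exact Real.norm_of_nonneg (Real.rpow_nonneg (hω.2 t ((hpos n).trans ht.1)).le _)
    · rw [div_lt_iff₀ (by positivity)]
      linarith [(Nat.cast_nonneg n : (0:ℝ) ≤ n)]

/-- If the dual weight is not integrable at `0`, there are nonnegative test functions whose
integral is large and controls their energy. -/
theorem exists_test_large_integral {p : ℝ} {ω : ℝ → ℝ} (hp : 1 < p) (hω : IsWeight ω)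
    (h : ¬ Bp0 p ω) (R : ℝ) :
    ∃ f : ℝ → ℝ, IsTest f ∧ R < ∫ t, f t ∧
      energy p ω f ≤ (3 / 2) ^ (p - 1) * ∫ t, f t := by
  have hp0 : 0 < p := by linarith
  have hp1 : 0 < p - 1 := by linarith
  obtain ⟨δ, hδ0, hδ1, hR⟩ := exists_lt_integral_of_not_Bp0 hω h (2 * R)
  obtain ⟨χ, hχ, h0, h1, hone, hsupp⟩ := exists_cutoff hδ0 hδ1
  have hsub : Set.Icc (δ / 2) (1 + δ / 2) ⊆ Set.Ioi 0 := fun t ht =>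
    lt_of_lt_of_le (by positivity) ht.1
  set w := fun t => ω t ^ (-1 / (p - 1)) with hw
  have hwc : ContinuousOn w (Set.Ioi 0) := hω.continuousOn_rpow _
  have hwpos : ∀ t : ℝ, 0 < t → 0 < w t := fun t ht => Real.rpow_pos_of_pos (hω.2 t ht) _
  obtain ⟨t₀, ht₀, hmin⟩ := isCompact_Icc.exists_isMinOn
    (Set.nonempty_Icc.2 (by linarith : δ / 2 ≤ 1 + δ / 2)) (hwc.mono hsub)
  obtain ⟨q, hq⟩ := exists_polynomial_near_of_continuousOn _ _ w (hwc.mono hsub) (w t₀ / 2)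
    (half_pos (hwpos _ (hsub ht₀)))
  have hqs : ContDiff ℝ (⊤ : ℕ∞) (fun t => q.eval t) := by
    simpa using q.contDiff_aeval (𝕜 := ℝ) (n := (⊤ : ℕ∞))
  have hqw : ∀ t ∈ Set.Icc (δ / 2) (1 + δ / 2), w t / 2 ≤ q.eval t ∧ q.eval t ≤ 3 / 2 * w t := by
    intro t ht
    have h2 := abs_lt.1 (hq t ht)
    have h3 : w t₀ ≤ w t := hmin ht
    constructor <;> linarith [h2.1, h2.2]
  have hf : IsTest (fun t => χ t * q.eval t) := hχ.mul_left hqs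
  have hout : ∀ t, t ∉ Set.Icc (δ / 2) (1 + δ / 2) → χ t = 0 := fun t ht =>
    image_eq_zero_of_notMem_tsupport fun h => ht (hsupp h)
  have hf0 : ∀ t, 0 ≤ χ t * q.eval t := by
    intro t
    by_cases ht : t ∈ Set.Icc (δ / 2) (1 + δ / 2)
    · exact mul_nonneg (h0 t) (by linarith [(hqw t ht).1, hwpos t (hsub ht)])
    · simp [hout t ht]
  have hfw : ∀ t : ℝ, 0 < t → χ t * q.eval t ≤ 3 / 2 * w t := by
    intro t ht0
    have := hwpos t ht0
    by_cases ht : t ∈ Set.Icc (δ / 2) (1 + δ / 2)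
    · have h2 := hqw t ht
      exact (mul_le_of_le_one_left (by linarith) (h1 t)).trans h2.2
    · rw [hout t ht]
      linarith
  refine ⟨_, hf, ?_, ?_⟩
  · have hsub' : Set.Ioc δ 1 ⊆ Set.Icc (δ / 2) (1 + δ / 2) := fun t ht =>
      ⟨by linarith [ht.1], by linarith [ht.2]⟩
    have hwint : IntegrableOn w (Set.Ioc δ 1) :=
      ((hwc.mono hsub).integrableOn_compact isCompact_Icc).mono_set hsub'
    calc R < (∫ t in Set.Ioc δ 1, w t) / 2 := by linarith
      _ = ∫ t in Set.Ioc δ 1, w t / 2 := (integral_div _ _).symm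
      _ ≤ ∫ t in Set.Ioc δ 1, χ t * q.eval t := by
          refine setIntegral_mono_on (hwint.div_const _) hf.integrable.integrableOn
            measurableSet_Ioc fun t ht => ?_
          rw [hone t ⟨ht.1.le, ht.2⟩, one_mul]
          exact (hqw t (hsub' ht)).1
      _ ≤ ∫ t, χ t * q.eval t :=
          setIntegral_le_integral hf.integrable (Eventually.of_forall hf0)
  · have hle : ∀ t : ℝ, 0 < t → |χ t * q.eval t| ^ p * ω t ≤
        (3 / 2) ^ (p - 1) * (χ t * q.eval t) := by
      intro t ht
      have hωt := hω.2 t ht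
      have hwω : w t ^ (p - 1) * ω t = 1 := by
        rw [hw]
        simp only
        rw [← Real.rpow_mul hωt.le, div_mul_cancel₀ _ hp1.ne', Real.rpow_neg_one,
          inv_mul_cancel₀ hωt.ne']
      have hpe : (χ t * q.eval t) ^ p = (χ t * q.eval t) * (χ t * q.eval t) ^ (p - 1) := by
        rw [← Real.rpow_one_add' (hf0 t) (by linarith)]
        congr 1
        ring
      rw [abs_of_nonneg (hf0 t), hpe]
      calc χ t * q.eval t * (χ t * q.eval t) ^ (p - 1) * ω t
          ≤ χ t * q.eval t * (3 / 2 * w t) ^ (p - 1) * ω t := by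
            have := Real.rpow_le_rpow (hf0 t) (hfw t ht) hp1.le
            have := mul_le_mul_of_nonneg_left this (hf0 t)
            exact mul_le_mul_of_nonneg_right this hωt.le
        _ = (3 / 2) ^ (p - 1) * (χ t * q.eval t) * (w t ^ (p - 1) * ω t) := by
            rw [Real.mul_rpow (by norm_num) (hwpos t ht).le]
            ring
        _ = _ := by rw [hwω, mul_one]
    calc energy p ω (fun t => χ t * q.eval t)
        ≤ ∫ t in Set.Ioi 0, (3 / 2) ^ (p - 1) * (χ t * q.eval t) :=
          setIntegral_mono_on (hf.finiteEnergy hp0 hω).2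
            (hf.integrable.const_mul _).integrableOn measurableSet_Ioi hle
      _ = (3 / 2) ^ (p - 1) * ∫ t in Set.Ioi 0, χ t * q.eval t := integral_const_mul _ _
      _ ≤ _ := by
          exact mul_le_mul_of_nonneg_left
            (setIntegral_le_integral hf.integrable (Eventually.of_forall hf0)) (by positivity)

theorem exists_test_integral_eq {p : ℝ} {ω : ℝ → ℝ} (hp : 1 < p) (hω : IsWeight ω)
    (h : ¬ Bp0 p ω) (m : ℝ) {ε : ℝ} (hε : 0 < ε) :
    ∃ ψ : ℝ → ℝ, IsTest ψ ∧ ∫ t, ψ t = m ∧ energy p ω ψ < ε := by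
  have hp1 : 0 < p - 1 := by linarith
  have hlim : Tendsto (fun I : ℝ => |m| ^ p * (3 / 2) ^ (p - 1) * I ^ (-(p - 1))) atTop (𝓝 0) := by
    simpa using (tendsto_rpow_neg_atTop hp1).const_mul (|m| ^ p * (3 / 2) ^ (p - 1))
  obtain ⟨R, hR⟩ := eventually_atTop.1 (hlim.eventually_lt_const hε)
  obtain ⟨f, hf, hRf, hE⟩ := exists_test_large_integral hp hω h (max R 0)
  set I := ∫ t, f t with hI
  have hI0 : 0 < I := (le_max_right _ _).trans_lt hRf
  refine ⟨fun t => f t * (m / I), hf.mul_left contDiff_const, ?_, ?_⟩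
  · rw [integral_mul_const, ← hI, mul_div_cancel₀ _ hI0.ne']
  · have hscale : energy p ω (fun t => f t * (m / I)) = |m / I| ^ p * energy p ω f := by
      rw [energy, energy, ← integral_const_mul]
      congr 1
      ext t
      rw [abs_mul, Real.mul_rpow (abs_nonneg _) (abs_nonneg _)]
      ring
    calc energy p ω (fun t => f t * (m / I)) = |m / I| ^ p * energy p ω f := hscale
      _ ≤ |m / I| ^ p * ((3 / 2) ^ (p - 1) * I) := by gcongr
      _ = |m| ^ p * (3 / 2) ^ (p - 1) * I ^ (-(p - 1)) := by
          rw [abs_div, abs_of_pos hI0, Real.div_rpow (abs_nonneg _) hI0.le,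
            show -(p - 1) = 1 - p by ring, Real.rpow_sub hI0, Real.rpow_one]
          ring
      _ < ε := hR I ((le_max_left _ _).trans hRf.le)

/-- If the dual weight is not integrable at `0`, derivatives of test functions are dense in
`L^p(ℝ₊, ω)`. -/
theorem FiniteEnergy.exists_test_deriv {p : ℝ} {ω g : ℝ → ℝ} (hp : 1 < p) (hω : IsWeight ω)
    (h : ¬ Bp0 p ω) (hg : FiniteEnergy p ω g) {ε : ℝ} (hε : 0 < ε) :
    ∃ φ : ℝ → ℝ, IsTest φ ∧ energy p ω (fun t => deriv φ t - g t) < ε := by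
  have hp0 : 0 < p := by linarith
  have hδ : 0 < ε / (2 * 2 ^ p) := by positivity
  obtain ⟨f, hf, hfg⟩ := hg.exists_test hp hω hδ
  obtain ⟨ψ, hψ, hψm, hψE⟩ := exists_test_integral_eq hp hω h (∫ t, f t) hδ
  obtain ⟨φ, hφ, hφd⟩ := (hf.sub hψ).exists_deriv_eq (by
    rw [integral_sub hf.integrable hψ.integrable, hψm, sub_self])
  refine ⟨φ, hφ, ?_⟩
  have hfge := ((hf.finiteEnergy hp0 hω).sub hp0.le hω hg).1
  have key := (hfge.sub hp0.le hω (hψ.finiteEnergy hp0 hω)).2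
  rw [hφd]
  calc energy p ω (fun t => f t - ψ t - g t)
      = energy p ω (fun t => f t - g t - ψ t) := by
        congr 1
        ext t
        ring
    _ ≤ _ := key
    _ < 2 ^ p * (ε / (2 * 2 ^ p) + ε / (2 * 2 ^ p)) := by gcongr
    _ = ε := by field_simp; norm_num

theorem BpInf.integrableOn_Ioi {p : ℝ} {ω : ℝ → ℝ} (hω : IsWeight ω) (hB : BpInf p ω)
    {t : ℝ} (ht : 0 < t) : IntegrableOn (fun t => ω t ^ (-1 / (p - 1))) (Set.Ioi t) := by
  have h1 : IntegrableOn (fun t => ω t ^ (-1 / (p - 1))) (Set.Icc t 1) :=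
    ContinuousOn.integrableOn_compact isCompact_Icc
      ((hω.continuousOn_rpow _).mono fun s hs => ht.trans_le hs.1)
  refine (h1.union hB).mono_set fun s hs => ?_
  rcases le_or_gt s 1 with h | h
  · exact Or.inl ⟨(Set.mem_Ioi.1 hs).le, h⟩
  · exact Or.inr h

theorem tendsto_neg_integral_Ioi {p : ℝ} {ω u' : ℝ → ℝ} (hp : 1 < p) (hω : IsWeight ω)
    (hu : FiniteEnergy p ω u') {φ : ℕ → ℝ → ℝ} (hφ : ∀ n, IsTest (φ n))
    (hlim : Tendsto (fun n => energy p ω (fun t => deriv (φ n) t - u' t)) atTop (𝓝 0))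
    {t : ℝ} (ht : 0 ≤ t) (hw : IntegrableOn (fun t => ω t ^ (-1 / (p - 1))) (Set.Ioi t)) :
    Tendsto (fun n => φ n t) atTop (𝓝 (-∫ τ in Set.Ioi t, u' τ)) := by
  have hp0 : 0 < p := by linarith
  rw [tendsto_iff_norm_sub_tendsto_zero]
  have h0 : Tendsto (fun n => energy p ω (fun t => deriv (φ n) t - u' t) ^ (1 / p) *
      (∫ τ in Set.Ioi t, ω τ ^ (-1 / (p - 1))) ^ (1 - 1 / p)) atTop (𝓝 0) := by
    have := (hlim.rpow_const (p := 1 / p) (Or.inr (by positivity))).mul_const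
      ((∫ τ in Set.Ioi t, ω τ ^ (-1 / (p - 1))) ^ (1 - 1 / p))
    rwa [Real.zero_rpow (by positivity), zero_mul] at this
  refine squeeze_zero (fun _ => norm_nonneg _) (fun n => ?_) h0
  rw [sub_neg_eq_add]
  exact abs_add_integral_Ioi_le hp hω hu (hφ n) ht hw

theorem MemD0.memRInf {p : ℝ} {ω u u' : ℝ → ℝ} (hp : 1 < p) (hω : IsWeight ω)
    (hB : BpInf p ω) (h : MemD0 p ω u u') : MemRInf p ω 0 u u' := by
  obtain ⟨hD, φ, hφ, hlim, hunif⟩ := h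
  have hu := hD.finiteEnergy
  refine ⟨hD, fun t ht => ?_⟩
  have hw := hB.integrableOn_Ioi hω ht
  refine ⟨(hu.integrableOn_and_abs_integral_le hp hω measurableSet_Ioi
    (Set.Ioi_subset_Ioi ht.le) hw).1, ?_⟩
  rw [zero_sub]
  refine tendsto_nhds_unique ?_ (tendsto_neg_integral_Ioi hp hω hu hφ hlim ht.le hw)
  exact (hunif {t} (by simpa using ht) isCompact_singleton).tendsto_at (Set.mem_singleton t)

theorem MemRInf.memD0 {p : ℝ} {ω u u' : ℝ → ℝ} (hp : 1 < p) (hω : IsWeight ω)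
    (hB : BpInf p ω) (h0 : ¬ Bp0 p ω) (h : MemRInf p ω 0 u u') : MemD0 p ω u u' := by
  obtain ⟨hD, hu⟩ := h
  have hp0 : 0 < p := by linarith
  have hfe := hD.finiteEnergy
  choose φ hφ hφE using fun n : ℕ =>
    hfe.exists_test_deriv hp hω h0 (Nat.one_div_pos_of_nat (α := ℝ) (n := n))
  have hlim : Tendsto (fun n => energy p ω (fun t => deriv (φ n) t - u' t)) atTop (𝓝 0) :=
    squeeze_zero (fun _ => energy_nonneg hω _) (fun n => (hφE n).le)
      tendsto_one_div_add_atTop_nhds_zero_nat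
  refine ⟨hD, φ, hφ, hlim, fun K hK hKc => ?_⟩
  rcases K.eq_empty_or_nonempty with rfl | hne
  · exact tendstoUniformlyOn_empty
  obtain ⟨a, haK, hamin⟩ := hKc.exists_isLeast hne
  have ha : 0 < a := hK haK
  have hwa := hB.integrableOn_Ioi hω ha
  have hbound : Tendsto (fun n => energy p ω (fun t => deriv (φ n) t - u' t) ^ (1 / p) *
      (∫ τ in Set.Ioi a, ω τ ^ (-1 / (p - 1))) ^ (1 - 1 / p)) atTop (𝓝 0) := by
    have := (hlim.rpow_const (p := 1 / p) (Or.inr (by positivity))).mul_const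
      ((∫ τ in Set.Ioi a, ω τ ^ (-1 / (p - 1))) ^ (1 - 1 / p))
    rwa [Real.zero_rpow (by positivity), zero_mul] at this
  rw [Metric.tendstoUniformlyOn_iff]
  intro ε hε
  filter_upwards [hbound.eventually_lt_const hε] with n hn t htK
  have ht : 0 < t := hK htK
  have hat : a ≤ t := hamin htK
  have hpos : ∀ s ∈ Set.Ioi a, 0 ≤ ω s ^ (-1 / (p - 1)) := fun s hs =>
    Real.rpow_nonneg (hω.2 s (ha.trans hs)).le _
  have hmono : ∫ τ in Set.Ioi t, ω τ ^ (-1 / (p - 1)) ≤ ∫ τ in Set.Ioi a, ω τ ^ (-1 / (p - 1)) := by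
    refine setIntegral_mono_set hwa ?_ (LE.le.eventuallyLE (Set.Ioi_subset_Ioi hat))
    filter_upwards [ae_restrict_mem measurableSet_Ioi] with s hs using hpos s hs
  have hnn : 0 ≤ ∫ τ in Set.Ioi t, ω τ ^ (-1 / (p - 1)) :=
    setIntegral_nonneg measurableSet_Ioi fun s hs => hpos s (hat.trans_lt hs)
  have hexp : 0 ≤ 1 - 1 / p := by
    rw [sub_nonneg, div_le_one hp0]
    exact hp.le
  rw [dist_comm, Real.dist_eq, (hu t ht).2, zero_sub, sub_neg_eq_add]
  refine (abs_add_integral_Ioi_le hp hω hfe (hφ n) ht.le (hB.integrableOn_Ioi hω ht)).trans_lt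
    (lt_of_le_of_lt ?_ hn)
  exact mul_le_mul_of_nonneg_left (Real.rpow_le_rpow hnn hmono hexp)
    (Real.rpow_nonneg (energy_nonneg hω _) _)

/-- If the dual weight is integrable on `(0,∞)`, its tail integral vanishes at infinity but is
not approximable by test functions. -/
theorem exists_memRInf_not_memD0 {p : ℝ} {ω : ℝ → ℝ} (hp : 1 < p) (hω : IsWeight ω)
    (hB : BpInf p ω) (h0 : Bp0 p ω) :
    ∃ u u' : ℝ → ℝ, MemRInf p ω 0 u u' ∧ ¬ MemD0 p ω u u' := by
  have hp1 : p - 1 ≠ 0 := by linarith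
  set w := fun t => ω t ^ (-1 / (p - 1)) with hw
  have hwint : IntegrableOn w (Set.Ioi 0) := by
    rw [← Set.Ioc_union_Ioi_eq_Ioi zero_le_one]
    exact IntegrableOn.union h0 hB
  have hwpos : ∀ t : ℝ, 0 < t → 0 < w t := fun t ht => Real.rpow_pos_of_pos (hω.2 t ht) _
  have hD : MemD p ω (fun t => 0 - ∫ τ in Set.Ioi t, w τ) w := by
    refine ⟨fun a b ha _ => hwint.mono_set fun t ht => ha.trans ht.1, fun a b ha hab => ?_, ?_⟩
    · have hsplit := setIntegral_union (Set.Ioc_disjoint_Ioi le_rfl) measurableSet_Ioi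
        (hwint.mono_set fun t (ht : t ∈ Set.Ioc a b) => ha.trans ht.1)
        (hwint.mono_set fun t (ht : t ∈ Set.Ioi b) => (ha.trans hab).trans ht)
      rw [Set.Ioc_union_Ioi_eq_Ioi hab.le] at hsplit
      simp only
      rw [intervalIntegral.integral_of_le hab.le, hsplit]
      ring
    · refine hwint.congr_fun (fun t ht => ?_) measurableSet_Ioi
      have hωt := hω.2 t ht
      rw [abs_of_pos (hwpos t ht)]
      simp only [hw]
      rw [← Real.rpow_mul hωt.le]
      nth_rw 3 [← Real.rpow_one (ω t)]
      rw [← Real.rpow_add hωt]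
      congr 1
      field_simp
      ring
  refine ⟨_, w, ⟨hD, fun t ht => ⟨hwint.mono_set (Set.Ioi_subset_Ioi ht.le), rfl⟩⟩, ?_⟩
  rintro ⟨-, φ, hφ, hlim, -⟩
  have hconv := tendsto_neg_integral_Ioi hp hω hD.finiteEnergy hφ hlim le_rfl hwint
  have hφ0 : ∀ n, φ n 0 = 0 := fun n =>
    image_eq_zero_of_notMem_tsupport fun h => lt_irrefl (0:ℝ) ((hφ n).2.2 h)
  simp only [hφ0] at hconv
  have hzero := tendsto_nhds_unique hconv tendsto_const_nhds
  have hposint : 0 < ∫ t in Set.Ioi 0, w t := by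
    rw [setIntegral_pos_iff_support_of_nonneg_ae _ hwint]
    · have : Function.support w ∩ Set.Ioi 0 = Set.Ioi 0 :=
        Set.inter_eq_right.2 fun t ht => (hwpos t ht).ne'
      simp [this]
    · filter_upwards [ae_restrict_mem measurableSet_Ioi] with t ht using (hwpos t ht).le
  linarith

/-- for `ω ∈ B_p(∞)`,
`D_0^{1,p}(ℝ₊,ω) = R^∞_{p,ω}(0)` iff `ω ∉ B_p(0)`. -/
theorem stmt12 (p : ℝ) (ω : ℝ → ℝ) (hp : 1 < p) (hω : IsWeight ω)
    (hB : BpInf p ω) :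
    (∀ u u' : ℝ → ℝ, MemD p ω u u' → (MemD0 p ω u u' ↔ MemRInf p ω 0 u u')) ↔
      ¬ Bp0 p ω := by
  constructor
  · intro h h0
    obtain ⟨u, u', hR, hnot⟩ := exists_memRInf_not_memD0 hp hω hB h0
    exact hnot ((h u u' hR.1).2 hR)
  · intro h0 u u' _
    exact ⟨fun h => h.memRInf hp hω hB, fun h => h.memD0 hp hω hB h0⟩

end
end
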